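/- For N > 1 coprime to 6 and 𝔣 = N·O_K in an imaginary quadratic field K ≠ ℚ(√−1), ℚ(√−3), the quantity ξ_N = h_E(φ_E(2/N)) − h_E(φ_E(1/N)) satisfies ξ_N^{12N} = (j(τ_K)²(j(τ_K)−1728)³/(2³⁰3²⁴))^{2N} · g_𝔣(C₃)/(g_𝔣(C₂)² g_𝔣(C₀)), and in particular ξ_N ≠ 0. -/

import Mathlib

open Complex

/-- The point `m ω₁ + n ω₂` of the lattice `ℤω₁ + ℤω₂`. -/
noncomputable def latticePt (om1 om2 : ℂ) (p : ℤ × ℤ) : ℂ := p.1 * om1 + p.2 * om2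

/-- `g₂(Λ)` for `Λ = ℤω₁ + ℤω₂`. -/
noncomputable def g2 (om1 om2 : ℂ) : ℂ :=
  60 * ∑' p : {p : ℤ × ℤ // p ≠ 0}, 1 / latticePt om1 om2 p.1 ^ 4

/-- `g₃(Λ)` for `Λ = ℤω₁ + ℤω₂`. -/
noncomputable def g3 (om1 om2 : ℂ) : ℂ :=
  140 * ∑' p : {p : ℤ × ℤ // p ≠ 0}, 1 / latticePt om1 om2 p.1 ^ 6

/-- `Δ(Λ) = g₂³ − 27g₃²`. -/
noncomputable def disc (om1 om2 : ℂ) : ℂ := g2 om1 om2 ^ 3 - 27 * g3 om1 om2 ^ 2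

/-- The Weierstrass ℘-function relative to `ℤω₁ + ℤω₂`. -/
noncomputable def wp (om1 om2 z : ℂ) : ℂ :=
  1 / z ^ 2 + ∑' p : {p : ℤ × ℤ // p ≠ 0},
    (1 / (z - latticePt om1 om2 p.1) ^ 2 - 1 / latticePt om1 om2 p.1 ^ 2)

/-- The elliptic modular function `j(τ) = 1728 g₂([τ,1])³ / Δ([τ,1])`. -/
noncomputable def jInv (tau : ℂ) : ℂ := 1728 * g2 tau 1 ^ 3 / disc tau 1

/-- The first Fricke function
`f_{[r₁,r₂]}(τ) = (g₂([τ,1])g₃([τ,1])/Δ([τ,1])) ℘(r₁τ + r₂; [τ,1])`. -/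
noncomputable def fricke (r1 r2 : ℚ) (tau : ℂ) : ℂ :=
  g2 tau 1 * g3 tau 1 / disc tau 1 * wp tau 1 ((r1 : ℂ) * tau + (r2 : ℂ))

/-- `(r₁,r₂)` lies in `ℤ²`. -/
def isIntPair (r : ℚ × ℚ) : Prop := ∃ m n : ℤ, r.1 = m ∧ r.2 = n

/-- `q^s = e^{2πiτs}`. -/
noncomputable def qpow (tau s : ℂ) : ℂ := Complex.exp (2 * Real.pi * Complex.I * tau * s)

/-- The second Bernoulli polynomial `B₂(X) = X² − X + 1/6`. -/
noncomputable def B2 (x : ℂ) : ℂ := x ^ 2 - x + 1 / 6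

/-- The Siegel function `g_{[r₁,r₂]}(τ)`. -/
noncomputable def siegel (r1 r2 : ℝ) (tau : ℂ) : ℂ :=
  -Complex.exp (Real.pi * Complex.I * r2 * (r1 - 1)) * qpow tau (B2 r1 / 2) *
    (1 - qpow tau r1 * Complex.exp (2 * Real.pi * Complex.I * r2)) *
    ∏' n : ℕ, ((1 - qpow tau ((n + 1 : ℕ) + r1) * Complex.exp (2 * Real.pi * Complex.I * r2)) *
      (1 - qpow tau ((n + 1 : ℕ) - r1) * Complex.exp (-(2 * Real.pi * Complex.I * r2))))

/-- `g₂` of a lattice given as an additive subgroup of `ℂ`. -/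
noncomputable def g2L (L : AddSubgroup ℂ) : ℂ :=
  60 * ∑' w : {x : L // x ≠ 0}, 1 / (w : ℂ) ^ 4

/-- `g₃` of a lattice given as an additive subgroup of `ℂ`. -/
noncomputable def g3L (L : AddSubgroup ℂ) : ℂ :=
  140 * ∑' w : {x : L // x ≠ 0}, 1 / (w : ℂ) ^ 6

/-- `Δ` of a lattice given as an additive subgroup of `ℂ`. -/
noncomputable def discL (L : AddSubgroup ℂ) : ℂ := g2L L ^ 3 - 27 * g3L L ^ 2

/-- The Weierstrass ℘-function of a lattice given as an additive subgroup of `ℂ`. -/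
noncomputable def wpL (L : AddSubgroup ℂ) (z : ℂ) : ℂ :=
  1 / z ^ 2 + ∑' w : {x : L // x ≠ 0}, (1 / (z - (w : ℂ)) ^ 2 - 1 / (w : ℂ) ^ 2)

/-- The Weber function `h_E ∘ φ_E` (in the generic case `j(E) ≠ 0, 1728`) of the CM
elliptic curve `y² = 4x³ − g₂(Λ)x − g₃(Λ)`, as a function of `z`:
`h_E(φ_E(z)) = (g₂(Λ)g₃(Λ)/Δ(Λ)) ℘(z; Λ)`. -/
noncomputable def weber (L : AddSubgroup ℂ) (z : ℂ) : ℂ :=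
  g2L L * g3L L / discL L * wpL L z

/-- `τ_K = (d_K + √d_K)/2`, where `√d_K` is the square root with positive imaginary
part of the (negative) discriminant `d_K`. -/
noncomputable def tauK (K : Type*) [Field K] [NumberField K] : ℂ :=
  ((NumberField.discr K : ℂ) + Real.sqrt (-(NumberField.discr K : ℝ)) * Complex.I) / 2

/-- The product `∏ (1 - qⁿ w)`. -/
noncomputable def xPhi (q w : ℂ) : ℂ := ∏' n : ℕ, (1 - q ^ n * w)

lemma xPhi_summable {q : ℂ} (hq : ‖q‖ < 1) (w : ℂ) : Summable fun n : ℕ => ‖-(q ^ n * w)‖ := by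
  simp only [norm_neg, norm_mul, norm_pow]
  exact (summable_geometric_of_lt_one (norm_nonneg _) hq).mul_right _

lemma xPhi_multipliable {q : ℂ} (hq : ‖q‖ < 1) (w : ℂ) :
    Multipliable fun n : ℕ => (1 - q ^ n * w) := by
  have := multipliable_one_add_of_summable (xPhi_summable hq w)
  simpa [sub_eq_add_neg] using this

lemma xPhi_succ {q : ℂ} (hq : ‖q‖ < 1) (w : ℂ) : xPhi q w = (1 - w) * xPhi q (q * w) := by
  unfold xPhi
  rw [tprod_eq_zero_mul']
  · simp [pow_succ, mul_assoc]
  · have := xPhi_multipliable hq (q * w)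
    simpa [pow_succ, mul_assoc] using this

lemma xPhi_ne_zero {q : ℂ} (hq : ‖q‖ < 1) {w : ℂ} (h : ∀ n : ℕ, q ^ n * w ≠ 1) :
    xPhi q w ≠ 0 := by
  have := tprod_one_add_ne_zero_of_summable (f := fun n : ℕ => -(q ^ n * w))
    (fun i => by
      have := h i
      rw [← sub_eq_add_neg, sub_ne_zero]; exact this.symm) (xPhi_summable hq w)
  simpa [xPhi, sub_eq_add_neg] using this

lemma xPhi_differentiable {q : ℂ} (hq : ‖q‖ < 1) : Differentiable ℂ (xPhi q) := by
  intro w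
  have hd : DifferentiableOn ℂ (xPhi q) (Metric.ball 0 (‖w‖ + 1)) := by
    have h := Summable.hasProdLocallyUniformlyOn_nat_one_add
      (f := fun (n : ℕ) (x : ℂ) => -(q ^ n * x)) (K := Metric.ball (0 : ℂ) (‖w‖ + 1))
      Metric.isOpen_ball (u := fun n => ‖q‖ ^ n * (‖w‖ + 1))
      ((summable_geometric_of_lt_one (norm_nonneg _) hq).mul_right _)
      (.of_forall fun n x hx => by
        have : ‖x‖ ≤ ‖w‖ + 1 := by simpa using (mem_ball_zero_iff.mp hx).le
        simp only [norm_neg, norm_mul, norm_pow]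
        gcongr)
      (fun n => by fun_prop)
    have h2 := h.differentiableOn (.of_forall fun _ => by
      simpa [Finset.prod_fn] using DifferentiableOn.finsetProd (fun _ _ => by fun_prop))
      Metric.isOpen_ball
    refine h2.congr fun x _ => ?_
    simp [xPhi, sub_eq_add_neg]
  exact hd.differentiableAt (Metric.isOpen_ball.mem_nhds (by simp))

/-- `e^{-πiz} Φ(e(z)) Φ(q e(-z))`, minus the theta function. -/
noncomputable def xT (τ z : ℂ) : ℂ :=
  exp (-(Real.pi * I * z)) * xPhi (exp (2 * Real.pi * I * τ)) (exp (2 * Real.pi * I * z)) *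
    xPhi (exp (2 * Real.pi * I * τ)) (exp (2 * Real.pi * I * τ) * exp (-(2 * Real.pi * I * z)))

lemma xq_norm {τ : ℂ} (hτ : 0 < τ.im) : ‖exp (2 * Real.pi * I * τ)‖ < 1 :=
  UpperHalfPlane.norm_exp_two_pi_I_lt_one ⟨τ, hτ⟩

lemma xT_differentiable {τ : ℂ} (hτ : 0 < τ.im) : Differentiable ℂ (xT τ) := by
  have h := xPhi_differentiable (xq_norm hτ)
  unfold xT
  fun_prop

lemma xT_eq {τ : ℂ} (hτ : 0 < τ.im) (z : ℂ) : xT τ z =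
    (exp (-(Real.pi * I * z)) - exp (Real.pi * I * z)) *
    (xPhi (exp (2 * Real.pi * I * τ)) (exp (2 * Real.pi * I * τ) * exp (2 * Real.pi * I * z)) *
    xPhi (exp (2 * Real.pi * I * τ)) (exp (2 * Real.pi * I * τ) * exp (-(2 * Real.pi * I * z)))) := by
  have h : exp (Real.pi * I * z) = exp (-(Real.pi * I * z)) * exp (2 * Real.pi * I * z) := by
    rw [← exp_add]; ring_nf
  rw [xT, xPhi_succ (xq_norm hτ) (exp (2 * Real.pi * I * z)), h]
  ring

lemma xT_neg {τ : ℂ} (hτ : 0 < τ.im) (z : ℂ) : xT τ (-z) = - xT τ z := by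
  rw [xT_eq hτ, xT_eq hτ]
  simp only [mul_neg, neg_neg]
  ring

lemma xT_add_one {τ : ℂ} (z : ℂ) : xT τ (z + 1) = - xT τ z := by
  have h1 : exp (2 * Real.pi * I * (z + 1)) = exp (2 * Real.pi * I * z) := by
    rw [mul_add, exp_add, mul_one, exp_two_pi_mul_I, mul_one]
  have h2 : exp (-(Real.pi * I * (z + 1))) = - exp (-(Real.pi * I * z)) := by
    rw [mul_add, neg_add, exp_add, mul_one, exp_neg (Real.pi * I), exp_pi_mul_I]; norm_num
  simp only [xT, exp_neg (2 * Real.pi * I * (z+1)), exp_neg (2 * Real.pi * I * z), h1, h2]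
  ring

lemma xT_add_tau {τ : ℂ} (hτ : 0 < τ.im) (z : ℂ) :
    xT τ (z + τ) = - exp (-(Real.pi * I * τ)) * exp (-(2 * Real.pi * I * z)) * xT τ z := by
  have h1 : exp (2 * Real.pi * I * (z + τ)) =
      exp (2 * Real.pi * I * τ) * exp (2 * Real.pi * I * z) := by
    rw [mul_add, exp_add, mul_comm]
  have h2 : exp (-(Real.pi * I * (z + τ))) = exp (-(Real.pi * I * τ)) * exp (-(Real.pi * I * z)) := by
    rw [mul_add, neg_add, exp_add, mul_comm]
  have h3 : exp (2 * Real.pi * I * τ) * exp (-(2 * Real.pi * I * (z + τ))) =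
      exp (-(2 * Real.pi * I * z)) := by
    rw [← exp_add]; ring_nf
  have h4 := xPhi_succ (xq_norm hτ) (exp (-(2 * Real.pi * I * z)))
  have h5 := xPhi_succ (xq_norm hτ) (exp (2 * Real.pi * I * z))
  have h6 : exp (-(2 * Real.pi * I * z)) * exp (2 * Real.pi * I * z) = 1 := by
    rw [← exp_add]; simp
  rw [xT, h1, h2, h3, h4, xT, h5]
  linear_combination (-exp (-(Real.pi * I * τ)) * exp (-(Real.pi * I * z)) *
    xPhi (exp (2 * Real.pi * I * τ)) (exp (2 * Real.pi * I * τ) * exp (2 * Real.pi * I * z)) *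
    xPhi (exp (2 * Real.pi * I * τ)) (exp (2 * Real.pi * I * τ) * exp (-(2 * Real.pi * I * z)))) * h6

lemma xT_zero {τ : ℂ} (hτ : 0 < τ.im) : xT τ 0 = 0 := by
  rw [xT_eq hτ]; simp

lemma xPhi_q_ne_zero {τ : ℂ} (hτ : 0 < τ.im) :
    xPhi (exp (2 * Real.pi * I * τ)) (exp (2 * Real.pi * I * τ)) ≠ 0 := by
  refine xPhi_ne_zero (xq_norm hτ) fun n h => ?_
  rw [← pow_succ] at h
  have := congrArg norm h
  rw [norm_pow, norm_one] at this
  exact absurd this (pow_lt_one₀ (norm_nonneg _) (xq_norm hτ) (by simp)).ne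

lemma xT_deriv_zero {τ : ℂ} (hτ : 0 < τ.im) : deriv (xT τ) 0 =
    -(2 * Real.pi * I) * xPhi (exp (2 * Real.pi * I * τ)) (exp (2 * Real.pi * I * τ)) ^ 2 := by
  have hP := xPhi_differentiable (xq_norm hτ)
  have h0 : xT τ = fun z => (exp (-(Real.pi * I * z)) - exp (Real.pi * I * z)) *
    (xPhi (exp (2 * Real.pi * I * τ)) (exp (2 * Real.pi * I * τ) * exp (2 * Real.pi * I * z)) *
    xPhi (exp (2 * Real.pi * I * τ)) (exp (2 * Real.pi * I * τ) * exp (-(2 * Real.pi * I * z)))) :=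
    funext fun z => xT_eq hτ z
  have h1 : HasDerivAt (fun z : ℂ => exp (-(Real.pi * I * z)) - exp (Real.pi * I * z))
      (-(2 * Real.pi * I)) 0 := by
    have a : HasDerivAt (fun z : ℂ => Real.pi * I * z) (Real.pi * I) 0 := by
      simpa using (hasDerivAt_id (0:ℂ)).const_mul (Real.pi * I)
    have := (a.neg.cexp).sub a.cexp
    convert! this using 1
    simp; ring
  have h2 : DifferentiableAt ℂ (fun z => (xPhi (exp (2 * Real.pi * I * τ)) (exp (2 * Real.pi * I * τ) * exp (2 * Real.pi * I * z)) *
    xPhi (exp (2 * Real.pi * I * τ)) (exp (2 * Real.pi * I * τ) * exp (-(2 * Real.pi * I * z))))) 0 := by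
    fun_prop
  rw [h0, (h1.fun_mul h2.hasDerivAt).deriv]
  simp; ring

lemma xT_ne_zero {τ : ℂ} (hτ : 0 < τ.im) {z : ℂ} (hz : ∀ m n : ℤ, (m : ℂ) * τ + n * 1 ≠ z) :
    xT τ z ≠ 0 := by
  unfold xT
  refine mul_ne_zero (mul_ne_zero (exp_ne_zero _) ?_) ?_
  · refine xPhi_ne_zero (xq_norm hτ) fun n h => ?_
    rw [← exp_nat_mul, ← exp_add, exp_eq_one_iff] at h
    obtain ⟨k, hk⟩ := h
    apply hz (-n) k
    have : (2 * Real.pi * I : ℂ) ≠ 0 := two_pi_I_ne_zero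
    apply mul_left_cancel₀ this
    push_cast
    linear_combination -hk
  · refine xPhi_ne_zero (xq_norm hτ) fun n h => ?_
    rw [← exp_nat_mul, ← exp_add, ← exp_add, exp_eq_one_iff] at h
    obtain ⟨k, hk⟩ := h
    apply hz (n + 1) (-k)
    have : (2 * Real.pi * I : ℂ) ≠ 0 := two_pi_I_ne_zero
    apply mul_left_cancel₀ this
    push_cast
    linear_combination hk

/-- The period pair `(τ, 1)`. -/
noncomputable def xL (τ : ℂ) (hτ : 0 < τ.im) : PeriodPair where
  ω₁ := τ
  ω₂ := 1
  indep := by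
    rw [LinearIndependent.pair_iff]
    intro s t h
    have h1 := congrArg Complex.im h
    have h2 := congrArg Complex.re h
    simp at h1 h2
    rcases h1 with h1 | h1
    · subst h1; simpa using h2
    · exact absurd h1 hτ.ne'

lemma mem_xL {τ : ℂ} (hτ : 0 < τ.im) {z : ℂ} :
    z ∈ (xL τ hτ).lattice ↔ ∃ m n : ℤ, (m : ℂ) * τ + n * 1 = z := PeriodPair.mem_lattice

lemma xT_ne_zero' {τ : ℂ} (hτ : 0 < τ.im) {z : ℂ} (hz : z ∉ (xL τ hτ).lattice) : xT τ z ≠ 0 :=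
  xT_ne_zero hτ fun m n h => hz ((mem_xL hτ).2 ⟨m, n, h⟩)

/-- The elliptic quotient of thetas. -/
noncomputable def xR (τ b z : ℂ) : ℂ := xT τ (z + b) * xT τ (z - b) / xT τ z ^ 2

lemma xR_periodic {τ : ℂ} (hτ : 0 < τ.im) (b : ℂ) (z l : ℂ) (hl : l ∈ (xL τ hτ).lattice) :
    xR τ b (z + l) = xR τ b z := by
  have h1 : Function.Periodic (xR τ b) 1 := by
    intro z
    simp only [xR]
    rw [show z + 1 + b = (z + b) + 1 by ring, show z + 1 - b = (z - b) + 1 by ring,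
      xT_add_one, xT_add_one, xT_add_one]
    ring
  have h2 : Function.Periodic (xR τ b) τ := by
    intro z
    simp only [xR]
    rw [show z + τ + b = (z + b) + τ by ring, show z + τ - b = (z - b) + τ by ring,
      xT_add_tau hτ, xT_add_tau hτ, xT_add_tau hτ]
    have e : exp (-(2 * Real.pi * I * (z + b))) * exp (-(2 * Real.pi * I * (z - b))) =
        exp (-(2 * Real.pi * I * z)) ^ 2 := by
      rw [sq, ← exp_add, ← exp_add]; ring_nf
    rw [show ∀ x y u v w : ℂ, x * y * u * (x * v * w) = x ^ 2 * (y * v) * (u * w) by intros; ring,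
      e, mul_pow, mul_pow]
    exact mul_div_mul_left _ _ (mul_ne_zero (pow_ne_zero _ (neg_ne_zero.2 (exp_ne_zero _)))
      (pow_ne_zero _ (exp_ne_zero _)))
  obtain ⟨m, n, rfl⟩ := (mem_xL hτ).1 hl
  have := (h1.int_mul n) (z + m * τ)
  rw [← add_assoc, this]
  exact (h2.int_mul m) z

lemma analyticAt_dslope {f : ℂ → ℂ} {x : ℂ} (h : AnalyticAt ℂ f x) : AnalyticAt ℂ (dslope f x) x := by
  obtain ⟨p, hp⟩ := h
  exact ⟨_, hp.has_fpower_series_dslope_fslope⟩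

open PeriodPair in
lemma wp_sub_wp {τ : ℂ} (hτ : 0 < τ.im) {a b : ℂ} (ha : a ∉ (xL τ hτ).lattice)
    (hb : b ∉ (xL τ hτ).lattice) :
    (xL τ hτ).weierstrassP a - (xL τ hτ).weierstrassP b =
      - (deriv (xT τ) 0 ^ 2 * (xT τ (a + b) * xT τ (a - b)) / (xT τ a ^ 2 * xT τ b ^ 2)) := by
  classical
  set L := xL τ hτ with hL
  have hTb : xT τ b ≠ 0 := xT_ne_zero' hτ hb
  have hT0 : deriv (xT τ) 0 ≠ 0 := by
    rw [xT_deriv_zero hτ]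
    exact mul_ne_zero (neg_ne_zero.2 two_pi_I_ne_zero) (pow_ne_zero _ (xPhi_q_ne_zero hτ))
  have hTd := xT_differentiable hτ
  have hTa : ∀ x, AnalyticAt ℂ (xT τ) x := fun x => hTd.analyticAt x
  set c : ℂ := deriv (xT τ) 0 ^ 2 / xT τ b ^ 2 with hc
  set S : ℂ → ℂ := dslope (xT τ) 0 with hS
  have hS0 : S 0 = deriv (xT τ) 0 := dslope_same _ _
  have hSz : ∀ z, z ≠ 0 → S z = xT τ z / z := by
    intro z hz
    rw [hS, dslope_of_ne _ hz, slope_def_field, xT_zero hτ, sub_zero, sub_zero]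
  have hSan : AnalyticAt ℂ S 0 := analyticAt_dslope (hTa 0)
  have hSneg : ∀ z, S (-z) = S z := by
    intro z
    by_cases hz : z = 0
    · simp [hz]
    · rw [hSz _ hz, hSz _ (neg_ne_zero.2 hz), xT_neg hτ, neg_div_neg_eq]
  set H : ℂ → ℂ := fun z => z ^ 2 * L.weierstrassPExcept 0 z + 1 - z ^ 2 * L.weierstrassP b +
    c * (xT τ (z + b) * xT τ (z - b)) / S z ^ 2 with hH
  have hHan : AnalyticAt ℂ H 0 := by
    have h1 : AnalyticAt ℂ (L.weierstrassPExcept 0) 0 := L.analyticAt_weierstrassPExcept 0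
    have h2 : AnalyticAt ℂ (fun z => xT τ (z + b)) 0 :=
      (hTd.comp (by fun_prop : Differentiable ℂ fun z : ℂ => z + b)).analyticAt 0
    have h3 : AnalyticAt ℂ (fun z => xT τ (z - b)) 0 :=
      (hTd.comp (by fun_prop : Differentiable ℂ fun z : ℂ => z - b)).analyticAt 0
    have h4 : S 0 ^ 2 ≠ 0 := pow_ne_zero _ (hS0 ▸ hT0)
    simp only [hH]
    fun_prop (disch := assumption)
  have hH0 : H 0 = 0 := by
    simp only [hH, hS0, hc]
    simp only [zero_add, zero_sub, xT_neg hτ]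
    field_simp
    ring
  have hHneg : ∀ z, H (-z) = H z := by
    intro z
    simp only [hH, hSneg, L.weierstrassPExcept_neg, neg_zero]
    rw [show -z + b = -(z - b) by ring, show -z - b = -(z + b) by ring, xT_neg hτ, xT_neg hτ]
    ring
  have hH' : deriv H 0 = 0 := by
    have := deriv_comp_neg H 0
    simp only [hHneg, neg_zero] at this
    exact CharZero.eq_neg_self_iff.1 this
  set K := dslope (dslope H 0) 0 with hK
  have hKan : AnalyticAt ℂ K 0 := analyticAt_dslope (analyticAt_dslope hHan)
  have hKz : ∀ z, z ≠ 0 → K z = H z / z ^ 2 := by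
    intro z hz
    rw [hK, dslope_of_ne _ hz, slope_def_field, dslope_same, hH', dslope_of_ne _ hz,
      slope_def_field, hH0]
    field_simp
    ring
  set G : ℂ → ℂ := fun z => if z ∈ L.lattice then K 0 else
    L.weierstrassP z - L.weierstrassP b + c * xR τ b z with hG
  have hGper : ∀ z l, l ∈ L.lattice → G (z + l) = G z := by
    intro z l hl
    simp only [hG]
    have e1 : z + l ∈ L.lattice ↔ z ∈ L.lattice := by
      simpa using (L.lattice.toAddSubgroup.add_mem_cancel_right (y := z) hl)
    have e2 := L.weierstrassP_add_coe z ⟨l, hl⟩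
    simp only at e2
    rw [xR_periodic hτ b z l hl, e2]
    simp only [e1]
  have hG0 : AnalyticAt ℂ G 0 := by
    refine hKan.congr ?_
    filter_upwards [L.compl_lattice_sdiff_singleton_mem_nhds 0] with z hz
    by_cases hz0 : z = 0
    · simp [hG, hz0]
    have hz' : z ∉ L.lattice := by simp_all
    have hTz : xT τ z ≠ 0 := xT_ne_zero' hτ hz'
    have e := L.weierstrassPExcept_def 0 z
    simp only [ZeroMemClass.coe_zero] at e
    simp only [hG, hz', if_false, hKz z hz0, hH, hSz z hz0, xR, e]
    field_simp
    simp
    ring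
  have hGan : ∀ x, AnalyticAt ℂ G x := by
    intro x
    by_cases hx : x ∈ L.lattice
    · have := hG0
      rw [← sub_self x] at this
      have h2 := this.comp (f := (· - x)) (by fun_prop)
      convert! h2 using 1
      ext z
      simp only [Function.comp]
      rw [sub_eq_add_neg, hGper z (-x) (neg_mem hx)]
    · have h1 := L.analyticOnNhd_weierstrassP _ hx
      have h2 : AnalyticAt ℂ (fun z => xT τ (z + b)) x :=
        (hTd.comp (by fun_prop : Differentiable ℂ fun z : ℂ => z + b)).analyticAt x
      have h3 : AnalyticAt ℂ (fun z => xT τ (z - b)) x :=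
        (hTd.comp (by fun_prop : Differentiable ℂ fun z : ℂ => z - b)).analyticAt x
      have h4 : xT τ x ^ 2 ≠ 0 := pow_ne_zero _ (xT_ne_zero' hτ hx)
      have h5 := hTa x
      have : AnalyticAt ℂ (fun z => L.weierstrassP z - L.weierstrassP b + c * xR τ b z) x := by
        simp only [xR]
        fun_prop (disch := assumption)
      apply this.congr
      filter_upwards [L.isClosed_lattice.isOpen_compl.mem_nhds hx] with x hx
      have : x ∉ L.lattice := hx
      simp [hG, this]
  have hGd : Differentiable ℂ G := fun x => (hGan x).differentiableAt
  have hconst := hGd.apply_eq_apply_of_bounded (IsZLattice.isCompact_range_of_periodic L.lattice _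
    hGd.continuous fun z w hw => hGper z w hw).isBounded a b
  have hGb : G b = 0 := by
    simp [hG, hb, xR, xT_zero hτ]
  rw [hGb] at hconst
  simp only [hG, ha, if_false, xR, hc] at hconst
  have hTa' : xT τ a ≠ 0 := xT_ne_zero' hτ ha
  rw [eq_neg_iff_add_eq_zero]
  refine Eq.trans ?_ hconst
  congr 1
  field_simp

open PeriodPair Filter Topology in
lemma lattice_stable (L : PeriodPair) {c : ℂ} (hc : c ≠ 0) (h2 : c ^ 4 * L.g₂ = L.g₂)
    (h3 : c ^ 6 * L.g₃ = L.g₃) {l : ℂ} (hl : l ∈ L.lattice) : l / c ∈ L.lattice := by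
  set E := L.weierstrassPExcept 0 with hE
  set E' := L.derivWeierstrassPExcept 0 with hE'
  set D : ℂ → ℂ := fun z => c ^ 2 * E (c * z) - E z with hD
  have hEan : AnalyticAt ℂ E 0 := L.analyticAt_weierstrassPExcept 0
  have hE'an : AnalyticAt ℂ E' 0 := L.analyticAt_derivWeierstrassPExcept 0
  have hEc : AnalyticAt ℂ (fun z => E (c * z)) 0 := by
    have : AnalyticAt ℂ E (c * 0) := by simpa using hEan
    exact this.comp (f := fun z => c * z) (by fun_prop)
  have hE'c : AnalyticAt ℂ (fun z => E' (c * z)) 0 := by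
    have : AnalyticAt ℂ E' (c * 0) := by simpa using hE'an
    exact this.comp (f := fun z => c * z) (by fun_prop)
  have hDan : AnalyticAt ℂ D 0 := (analyticAt_const.mul hEc).sub hEan
  have hgood : ∀ᶠ z in 𝓝[≠] (0 : ℂ), z ≠ 0 ∧ z ∉ L.lattice ∧ c * z ∉ L.lattice := by
    have hU := L.compl_lattice_sdiff_singleton_mem_nhds 0
    have hV : ∀ᶠ z in 𝓝 (0 : ℂ), c * z ∈ ((L.lattice : Set ℂ) \ {0})ᶜ := by
      have ht : Tendsto (fun z : ℂ => c * z) (𝓝 0) (𝓝 0) := by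
        have : Continuous (fun z : ℂ => c * z) := by fun_prop
        simpa using this.tendsto 0
      exact ht hU
    filter_upwards [mem_nhdsWithin_of_mem_nhds hU, mem_nhdsWithin_of_mem_nhds hV,
      self_mem_nhdsWithin] with z h1 h2 h3
    have h3 : z ≠ 0 := h3
    have := mul_ne_zero hc h3
    simp_all
  have hP : ∀ z, L.weierstrassP z = E z + 1 / z ^ 2 := by
    intro z
    have := L.weierstrassPExcept_add 0 z
    simp only [ZeroMemClass.coe_zero] at this
    rw [← this]; simp [hE]
  have hP' : ∀ z, L.derivWeierstrassP z = E' z - 2 / z ^ 3 := by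
    intro z
    have := L.derivWeierstrassPExcept_sub 0 z
    simp only [ZeroMemClass.coe_zero] at this
    rw [← this]; simp [hE']
  have hderiv : ∀ᶠ z in 𝓝[≠] (0 : ℂ), deriv D z = c ^ 3 * E' (c * z) - E' z := by
    filter_upwards [hgood] with z hz
    have hd : ∀ w, w ∉ L.lattice → HasDerivAt E (E' w) w := by
      intro w hw
      have hw' : w ∈ ((L.lattice : Set ℂ) \ {0})ᶜ := by
        simp; intro h; exact absurd h hw
      have := ((L.differentiableOn_weierstrassPExcept 0).differentiableAt
        (L.isOpen_compl_lattice_sdiff.mem_nhds hw')).hasDerivAt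
      rwa [L.eqOn_deriv_weierstrassPExcept_derivWeierstrassPExcept 0 hw'] at this
    have h1 := (hd (c * z) hz.2.2).comp z ((hasDerivAt_id z).const_mul c)
    have h2 := (h1.const_mul (c ^ 2)).sub (hd z hz.2.1)
    have h3 : HasDerivAt D (c ^ 3 * E' (c * z) - E' z) z := by
      convert! h2 using 1
      simp; ring
    exact h3.deriv
  set A : ℂ → ℂ := fun z => (c * z) ^ 3 * E' (c * z) - 2 + z ^ 3 * E' z - 2 with hA
  set m : ℂ → ℂ := fun z => (c * z) ^ 2 * E (c * z) + 1 with hm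
  set p : ℂ → ℂ := fun z => z ^ 2 * E z + 1 with hp
  set B : ℂ → ℂ := fun z => 4 * (m z ^ 2 + m z * p z + p z ^ 2) - L.g₂ * z ^ 4 with hB
  have hAan : AnalyticAt ℂ A 0 :=
    ((((((analyticAt_const.mul analyticAt_id).pow 3).mul hE'c).sub analyticAt_const).add
      ((analyticAt_id.pow 3).mul hE'an)).sub analyticAt_const)
  have hman : AnalyticAt ℂ m 0 :=
    (((analyticAt_const.mul analyticAt_id).pow 2).mul hEc).add analyticAt_const
  have hpan : AnalyticAt ℂ p 0 :=
    ((analyticAt_id.pow 2).mul hEan).add analyticAt_const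
  have hBan : AnalyticAt ℂ B 0 :=
    (analyticAt_const.mul (((hman.pow 2).add (hman.mul hpan)).add (hpan.pow 2))).sub
      (analyticAt_const.mul (analyticAt_id.pow 4))
  have hA0 : A 0 = -4 := by simp [hA]; norm_num
  have hB0 : B 0 = 12 := by simp [hB, hm, hp]; norm_num
  have hrel : ∀ᶠ z in 𝓝[≠] (0 : ℂ), z * deriv D z * A z = D z * B z := by
    filter_upwards [hgood, hderiv] with z hz hdz
    have r1 := L.derivWeierstrassP_sq z hz.2.1
    have r2 := L.derivWeierstrassP_sq (c * z) hz.2.2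
    rw [hP, hP'] at r1 r2
    have hz0 := hz.1
    have e1 : c ^ 3 * E' (c * z) - E' z =
        c ^ 3 * (E' (c * z) - 2 / (c * z) ^ 3) - (E' z - 2 / z ^ 3) := by
      field_simp; ring
    have e2 : A z = z ^ 3 * (c ^ 3 * (E' (c * z) - 2 / (c * z) ^ 3) + (E' z - 2 / z ^ 3)) := by
      simp only [hA]; field_simp; ring
    have e3 : m z = z ^ 2 * (c ^ 2 * (E (c * z) + 1 / (c * z) ^ 2)) := by
      simp only [hm]; field_simp
    have e4 : p z = z ^ 2 * (E z + 1 / z ^ 2) := by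
      simp only [hp]; field_simp
    have e5 : D z = c ^ 2 * (E (c * z) + 1 / (c * z) ^ 2) - (E z + 1 / z ^ 2) := by
      simp only [hD]; field_simp; ring
    rw [hdz, e1, e2, e5]
    simp only [hB, e3, e4]
    generalize E' (c * z) - 2 / (c * z) ^ 3 = x' at *
    generalize E' z - 2 / z ^ 3 = y' at *
    generalize E (c * z) + 1 / (c * z) ^ 2 = x at *
    generalize E z + 1 / z ^ 2 = y at *
    linear_combination z ^ 4 * (c ^ 6 * r2 - r1) - z ^ 4 * c ^ 2 * x * h2 - z ^ 4 * h3
  have hDzero : ∀ᶠ z in 𝓝 (0 : ℂ), D z = 0 := by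
    by_contra hne
    obtain ⟨n, F, hFan, hF0, hF⟩ := hDan.exists_eventuallyEq_pow_smul_nonzero_iff.2 hne
    simp only [sub_zero, smul_eq_mul] at hF
    have hlim : ∀ᶠ z in 𝓝[≠] (0 : ℂ), (n * F z + z * deriv F z) * A z - F z * B z = 0 := by
      filter_upwards [hrel, mem_nhdsWithin_of_mem_nhds hF.eventually_nhds,
        mem_nhdsWithin_of_mem_nhds hFan.eventually_analyticAt, self_mem_nhdsWithin] with z h1 h2 h3 h4
      have hz0 : z ≠ 0 := h4
      have hdz : deriv D z = n * z ^ (n - 1) * F z + z ^ n * deriv F z := by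
        rw [EventuallyEq.deriv_eq h2]
        have := ((hasDerivAt_pow n z).mul h3.differentiableAt.hasDerivAt).deriv
        exact this
      have hzn : z * (n * z ^ (n - 1)) = n * z ^ n := by
        rcases n with _ | n
        · simp
        · simp [pow_succ]; ring
      rw [hdz, h2.self_of_nhds] at h1
      have : z ^ n * ((n * F z + z * deriv F z) * A z - F z * B z) = 0 := by
        linear_combination h1 - F z * A z * hzn
      exact (mul_eq_zero.1 this).resolve_left (pow_ne_zero _ hz0)
    have hcont : ContinuousAt (fun z => (n * F z + z * deriv F z) * A z - F z * B z) 0 := by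
      have := hFan.deriv.continuousAt
      have := hFan.continuousAt
      have := hAan.continuousAt
      have := hBan.continuousAt
      fun_prop
    have ht : Tendsto (fun z => (n * F z + z * deriv F z) * A z - F z * B z) (𝓝[≠] 0) (𝓝 0) :=
      (tendsto_congr' hlim).2 tendsto_const_nhds
    have := tendsto_nhds_unique (hcont.tendsto.mono_left nhdsWithin_le_nhds) ht
    simp only [hA0, hB0, zero_mul, add_zero] at this
    have h5 : F 0 * ((n + 3 : ℕ) : ℂ) = 0 := by push_cast; linear_combination -this / 4
    rcases mul_eq_zero.1 h5 with h | h
    · exact hF0 h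
    · exact absurd h (Nat.cast_ne_zero.2 (by omega))
  set f : ℂ → ℂ := fun z => c ^ 2 * L.weierstrassP (c * z) - L.weierstrassP z with hf
  have hPm := L.meromorphic_weierstrassP
  have hfm : MeromorphicOn f Set.univ := by
    intro z _
    have : MeromorphicAt (fun z => L.weierstrassP (c * z)) z :=
      (hPm (c * z)).comp_analyticAt (f := L.weierstrassP) (g := fun z => c * z) (by fun_prop)
    exact ((MeromorphicAt.const (c ^ 2) z).mul this).sub (hPm z)
  have hf0 : meromorphicOrderAt f 0 = ⊤ := by
    rw [meromorphicOrderAt_eq_top_iff]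
    filter_upwards [hgood, mem_nhdsWithin_of_mem_nhds hDzero] with z hz h0
    have hz0 := hz.1
    rw [← h0]
    simp only [hf, hP, hD]
    field_simp
    ring
  have hfl : meromorphicOrderAt f (l / c) = ⊤ := by
    by_contra h
    exact (hfm.exists_meromorphicOrderAt_ne_top_iff_forall_mem isConnected_univ).1
      ⟨l / c, Set.mem_univ _, h⟩ 0 (Set.mem_univ _) hf0
  by_contra hlc
  rw [meromorphicOrderAt_eq_top_iff] at hfl
  have hPl : ContinuousAt L.weierstrassP (l / c) := (L.analyticOnNhd_weierstrassP _ hlc).continuousAt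
  have ht0 : Tendsto (fun z : ℂ => z / c) (𝓝[≠] l) (𝓝[≠] (l / c)) := by
    refine tendsto_nhdsWithin_iff.2 ⟨?_, ?_⟩
    · have : Continuous (fun z : ℂ => z / c) := by fun_prop
      exact (this.tendsto l).mono_left nhdsWithin_le_nhds
    · filter_upwards [self_mem_nhdsWithin] with z hz
      have hz : z ≠ l := hz
      intro h
      exact hz ((div_left_inj' hc).1 h)
  have ht1 : Tendsto L.weierstrassP (𝓝[≠] l) (𝓝 (L.weierstrassP (l / c) / c ^ 2)) := by
    have := ((hPl.tendsto.mono_left nhdsWithin_le_nhds).comp ht0).div_const (c ^ 2)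
    refine this.congr' ?_
    filter_upwards [ht0.eventually hfl] with z hz
    simp only [hf, mul_div_cancel₀ z hc] at hz
    simp only [Function.comp]
    field_simp
    linear_combination -hz
  have := (tendsto_nhds_iff_meromorphicOrderAt_nonneg (hPm l)).1 ⟨_, ht1⟩
  rw [L.order_weierstrassP l hl] at this
  exact absurd this (by decide)

lemma xcl {τ : ℂ} (hτ : 0 < τ.im) :
    AddSubgroup.closure {τ, 1} = (xL τ hτ).lattice.toAddSubgroup := by
  ext z
  rw [Submodule.mem_toAddSubgroup, mem_xL hτ, AddSubgroup.mem_closure_pair]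
  simp only [zsmul_eq_mul]

lemma xtsum_ne {α : Type*} [Zero α] (f : α → ℂ) (h0 : f 0 = 0) :
    ∑' w : {x : α // x ≠ 0}, f w = ∑' w, f w := by
  refine tsum_subtype_eq_of_support_subset (s := {x : α | x ≠ 0}) (f := f) ?_
  intro x hx h
  exact hx (h ▸ h0)

lemma xg2L (L : PeriodPair) : g2L L.lattice.toAddSubgroup = L.g₂ := by
  rw [g2L, PeriodPair.g₂, PeriodPair.G]
  congr 1
  rw [xtsum_ne (α := L.lattice.toAddSubgroup) (fun w => 1 / (w : ℂ) ^ 4) (by simp)]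
  simp only [one_div]
  rfl

lemma xg3L (L : PeriodPair) : g3L L.lattice.toAddSubgroup = L.g₃ := by
  rw [g3L, PeriodPair.g₃, PeriodPair.G]
  congr 1
  rw [xtsum_ne (α := L.lattice.toAddSubgroup) (fun w => 1 / (w : ℂ) ^ 6) (by simp)]
  simp only [one_div]
  rfl

lemma xwpL (L : PeriodPair) (z : ℂ) : wpL L.lattice.toAddSubgroup z = L.weierstrassP z := by
  have h := L.weierstrassPExcept_add 0 z
  rw [← h, wpL, PeriodPair.weierstrassPExcept]
  have h2 := xtsum_ne (α := L.lattice.toAddSubgroup)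
    (fun w => if (w : ℂ) = 0 then 0 else (1 / (z - (w : ℂ)) ^ 2 - 1 / (w : ℂ) ^ 2)) (by simp)
  have h3 : ∑' w : {x : L.lattice.toAddSubgroup // x ≠ 0},
      (1 / (z - (w : ℂ)) ^ 2 - 1 / (w : ℂ) ^ 2) =
      ∑' w : {x : L.lattice.toAddSubgroup // x ≠ 0},
      (if (w : ℂ) = 0 then 0 else (1 / (z - (w : ℂ)) ^ 2 - 1 / (w : ℂ) ^ 2)) := by
    refine tsum_congr fun w => ?_
    have : (w : ℂ) ≠ 0 := fun h => w.2 (Subtype.ext h)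
    rw [if_neg this]
  rw [h3, h2]
  simp only [ZeroMemClass.coe_zero]
  rw [add_comm]
  congr 1
  simp

lemma xG_prod {τ : ℂ} (hτ : 0 < τ.im) (n : ℕ) :
    (xL τ hτ).G n = ∑' p : ℤ × ℤ, ((latticePt τ 1 p) ^ n)⁻¹ := by
  rw [PeriodPair.G, ← (xL τ hτ).latticeEquivProd.symm.toEquiv.tsum_eq]
  refine tsum_congr fun p => ?_
  have := (xL τ hτ).latticeEquiv_symm_apply p
  simp only [LinearEquiv.coe_toEquiv]
  rw [this]; rfl

lemma xg2 {τ : ℂ} (hτ : 0 < τ.im) : g2 τ 1 = (xL τ hτ).g₂ := by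
  rw [g2, PeriodPair.g₂, xG_prod]
  congr 1
  rw [xtsum_ne (α := ℤ × ℤ) (fun w => 1 / latticePt τ 1 w ^ 4) (by simp [latticePt])]
  simp only [one_div]

lemma xg3 {τ : ℂ} (hτ : 0 < τ.im) : g3 τ 1 = (xL τ hτ).g₃ := by
  rw [g3, PeriodPair.g₃, xG_prod]
  congr 1
  rw [xtsum_ne (α := ℤ × ℤ) (fun w => 1 / latticePt τ 1 w ^ 6) (by simp [latticePt])]
  simp only [one_div]

lemma xG_eis {τ : ℂ} (hτ : 0 < τ.im) {k : ℕ} (hk : 3 ≤ k) :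
    (xL τ hτ).G k = 2 * riemannZeta k * ModularForm.E hk ⟨τ, hτ⟩ := by
  have h := tsum_eisSummand_eq_riemannZeta_mul_eisensteinSeries hk ⟨τ, hτ⟩
  have h2 : ModularForm.E hk ⟨τ, hτ⟩ = (1 / 2 : ℂ) *
    eisensteinSeries (N := 1) 0 k ⟨τ, hτ⟩ := rfl
  rw [h2, xG_prod]
  have h3 : ∑' p : ℤ × ℤ, ((latticePt τ 1 p) ^ k)⁻¹ =
      ∑' v : Fin 2 → ℤ, EisensteinSeries.eisSummand k v ⟨τ, hτ⟩ := by
    rw [← (finTwoArrowEquiv ℤ).symm.tsum_eq]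
    refine tsum_congr fun p => ?_
    simp [EisensteinSeries.eisSummand, latticePt]
  rw [h3, h]; ring

lemma xbern6 : bernoulli 6 = 1 / 42 := by
  have h5 : bernoulli' 5 = 0 := by
    rw [bernoulli'_def]
    norm_num [Finset.sum_range_succ, show Nat.choose 5 2 = 10 by decide,
      show Nat.choose 5 3 = 10 by decide, show Nat.choose 5 4 = 5 by decide]
  rw [bernoulli_eq_bernoulli'_of_ne_one (by norm_num), bernoulli'_def]
  norm_num [Finset.sum_range_succ, h5, show Nat.choose 6 2 = 15 by decide,
      show Nat.choose 6 3 = 20 by decide, show Nat.choose 6 4 = 15 by decide,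
      show Nat.choose 6 5 = 6 by decide]

lemma xzeta6 : riemannZeta 6 = (Real.pi : ℂ) ^ 6 / 945 := by
  have := riemannZeta_two_mul_nat (k := 3) (by norm_num)
  norm_num at this
  rw [this, xbern6]
  norm_num [Nat.factorial]
  ring

lemma xdisc_eq {τ : ℂ} (hτ : 0 < τ.im) :
    (xL τ hτ).g₂ ^ 3 - 27 * (xL τ hτ).g₃ ^ 2 =
      (2 * Real.pi) ^ 12 * ModularForm.discriminant ⟨τ, hτ⟩ := by
  rw [ModularForm.discriminant_eq_E₄_cube_sub_E₆_sq, PeriodPair.g₂, PeriodPair.g₃,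
    xG_eis hτ (k := 4) (by norm_num), xG_eis hτ (k := 6) (by norm_num)]
  push_cast
  rw [xzeta6, riemannZeta_four]
  ring

lemma xdisc_ne {τ : ℂ} (hτ : 0 < τ.im) :
    (xL τ hτ).g₂ ^ 3 - 27 * (xL τ hτ).g₃ ^ 2 ≠ 0 := by
  rw [xdisc_eq]
  have := Complex.ofReal_ne_zero.2 Real.pi_ne_zero
  exact mul_ne_zero (pow_ne_zero _ (mul_ne_zero two_ne_zero this)) (ModularForm.discriminant_ne_zero _)

lemma xdisc_prod {τ : ℂ} (hτ : 0 < τ.im) :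
    (xL τ hτ).g₂ ^ 3 - 27 * (xL τ hτ).g₃ ^ 2 =
      (2 * Real.pi) ^ 12 * (exp (2 * Real.pi * I * τ) *
        xPhi (exp (2 * Real.pi * I * τ)) (exp (2 * Real.pi * I * τ)) ^ 24) := by
  rw [xdisc_eq, ModularForm.discriminant_eq_q_prod]
  congr 1
  have hq : Function.Periodic.qParam 1 τ = exp (2 * Real.pi * I * τ) := by
    simp [Function.Periodic.qParam]
  simp only [ModularForm.eta_q, hq]
  congr 1
  rw [Multipliable.tprod_pow (f := fun n : ℕ => 1 - exp (2 * Real.pi * I * τ) ^ (n + 1))]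
  · simp only [xPhi, pow_succ]
  · simpa only [pow_succ] using xPhi_multipliable (xq_norm hτ) (exp (2 * Real.pi * I * τ))

lemma xsiegel {τ : ℂ} (hτ : 0 < τ.im) (r : ℝ) :
    siegel 0 r τ = - qpow τ (B2 0 / 2) * xT τ r := by
  have hq := xq_norm hτ
  rw [siegel, xT]
  set q := exp (2 * Real.pi * I * τ) with hqd
  set w := exp (2 * Real.pi * I * r) with hw
  have hw' : exp (-(2 * Real.pi * I * r)) = exp (-(2 * Real.pi * I * (r : ℂ))) := rfl
  have e1 : ∀ n : ℕ, qpow τ ((n + 1 : ℕ) + (0 : ℝ)) = q ^ n * q := by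
    intro n
    rw [qpow, ← pow_succ, hqd, ← exp_nat_mul]; push_cast; congr 1; ring
  have e2 : ∀ n : ℕ, qpow τ ((n + 1 : ℕ) - (0 : ℝ)) = q ^ n * q := by
    intro n
    rw [qpow, ← pow_succ, hqd, ← exp_nat_mul]; push_cast; congr 1; ring
  have e3 : qpow τ (0 : ℝ) = 1 := by simp [qpow]
  simp only [e1, e2, e3]
  rw [Multipliable.tprod_mul]
  · rw [xPhi_succ hq w]
    simp only [xPhi, mul_assoc, ofReal_zero]
    have : exp (Real.pi * (I * (r * (0 - 1)))) = exp (-(Real.pi * (I * r))) := by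
      congr 1; ring
    rw [this]
    ring
  · simpa only [mul_assoc] using xPhi_multipliable hq (q * w)
  · simpa only [mul_assoc] using xPhi_multipliable hq (q * exp (-(2 * Real.pi * I * (r : ℂ))))

lemma xQ12 (τ : ℂ) : qpow τ (B2 0 / 2) ^ 12 = exp (2 * Real.pi * I * τ) := by
  rw [qpow, ← exp_nat_mul, B2]
  congr 1
  push_cast; ring
lemma xtau_im (K : Type*) [Field K] [NumberField K] :
    (tauK K).im = Real.sqrt (-(NumberField.discr K : ℝ)) / 2 := by
  have : tauK K = (((NumberField.discr K : ℝ) / 2 : ℝ) : ℂ) +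
      ((Real.sqrt (-(NumberField.discr K : ℝ)) / 2 : ℝ) : ℂ) * I := by
    rw [tauK]; push_cast; ring
  rw [this]
  simp

lemma xtau_pos (K : Type*) [Field K] [NumberField K] (hneg : NumberField.discr K < 0) :
    0 < (tauK K).im := by
  rw [xtau_im]
  have : (0 : ℝ) < -(NumberField.discr K : ℝ) := by exact_mod_cast neg_pos.2 hneg
  positivity

lemma xint_sq {K : Type*} [Field K] [NumberField K] (hneg : NumberField.discr K < 0)
    {z : ℂ} (hz : z ∈ (xL (tauK K) (xtau_pos K hneg)).lattice) :
    ∃ m : ℤ, (m : ℝ) ^ 2 * -(NumberField.discr K : ℝ) = 4 * z.im ^ 2 := by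
  obtain ⟨m, n, h⟩ := (mem_xL _).1 hz
  have h' := congrArg Complex.im h
  simp only [Complex.add_im, Complex.mul_im, Complex.intCast_re, Complex.intCast_im,
    Complex.one_im, Complex.one_re, xtau_im] at h'
  have h0 : (0 : ℝ) ≤ -(NumberField.discr K : ℝ) := by
    exact_mod_cast (neg_pos.2 hneg).le
  refine ⟨m, ?_⟩
  rw [← h']
  have := Real.sq_sqrt h0
  linear_combination -(m : ℝ) ^ 2 * this

lemma xg3_ne (K : Type*) [Field K] [NumberField K]
    (h2 : Module.finrank ℚ K = 2) (hneg : NumberField.discr K < 0)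
    (h4 : NumberField.discr K ≠ -4) :
    (xL (tauK K) (xtau_pos K hneg)).g₃ ≠ 0 := by
  intro h0
  have h1 : (1 : ℂ) ∈ (xL (tauK K) (xtau_pos K hneg)).lattice :=
    (mem_xL _).2 ⟨0, 1, by simp⟩
  have hs := lattice_stable _ (c := I) I_ne_zero (by rw [I_pow_four, one_mul])
    (by rw [h0]; simp) h1
  obtain ⟨m, hm⟩ := xint_sq hneg hs
  simp at hm
  have hm' : m ^ 2 * -(NumberField.discr K) = 4 := by
    have : ((m ^ 2 * -(NumberField.discr K) : ℤ) : ℝ) = (4 : ℤ) := by push_cast; linarith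
    exact_mod_cast this
  have hd := NumberField.abs_discr_gt_two (K := K) (by omega)
  rw [abs_of_neg hneg] at hd
  have hm1 : m ^ 2 < 2 := by nlinarith [sq_nonneg m]
  have hm0 : m ^ 2 ≠ 0 := by intro h; rw [h] at hm'; simp at hm'
  have : m ^ 2 = 1 := by have := sq_nonneg m; omega
  rw [this] at hm'
  omega

lemma xg2_ne (K : Type*) [Field K] [NumberField K]
    (h2 : Module.finrank ℚ K = 2) (hneg : NumberField.discr K < 0)
    (h3 : NumberField.discr K ≠ -3) :
    (xL (tauK K) (xtau_pos K hneg)).g₂ ≠ 0 := by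
  intro h0
  have h1 : (1 : ℂ) ∈ (xL (tauK K) (xtau_pos K hneg)).lattice :=
    (mem_xL _).2 ⟨0, 1, by simp⟩
  set s : ℝ := Real.sqrt 3 with hs
  have hs2 : (s : ℂ) ^ 2 = 3 := by
    have : s ^ 2 = 3 := Real.sq_sqrt (by norm_num)
    exact_mod_cast this
  set c : ℂ := (1 + s * I) / 2 with hc
  have hc2 : c ^ 2 = c - 1 := by
    rw [hc]; linear_combination (-(1 : ℂ) / 4) * hs2 + (s : ℂ) ^ 2 / 4 * I_sq
  have hc3 : c ^ 3 = -1 := by linear_combination (c + 1) * hc2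
  have hc6 : c ^ 6 = 1 := by linear_combination (c ^ 3 - 1) * hc3
  have hc0 : c ≠ 0 := by rintro h; rw [h] at hc3; norm_num at hc3
  have hst := lattice_stable _ (c := c) hc0 (by rw [h0]; simp) (by rw [hc6, one_mul]) h1
  have hinv : 1 / c = (((1 / 2 : ℝ)) : ℂ) + ((-s / 2 : ℝ) : ℂ) * I := by
    rw [div_eq_iff hc0, hc]; push_cast
    linear_combination (-(1 : ℂ) / 4) * hs2 + (s : ℂ) ^ 2 / 4 * I_sq
  obtain ⟨m, hm⟩ := xint_sq hneg hst
  have him : (1 / c).im = -s / 2 := by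
    rw [hinv, Complex.add_im, Complex.ofReal_im, Complex.im_ofReal_mul]
    simp
  rw [him] at hm
  have hs3 : s ^ 2 = 3 := Real.sq_sqrt (by norm_num)
  have hm' : m ^ 2 * -(NumberField.discr K) = 3 := by
    have : ((m ^ 2 * -(NumberField.discr K) : ℤ) : ℝ) = (3 : ℤ) := by push_cast; linarith
    exact_mod_cast this
  have hd := NumberField.abs_discr_gt_two (K := K) (by omega)
  rw [abs_of_neg hneg] at hd
  have hm1 : m ^ 2 < 2 := by nlinarith [sq_nonneg m]
  have hm0 : m ^ 2 ≠ 0 := by intro h; rw [h] at hm'; simp at hm'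
  have : m ^ 2 = 1 := by have := sq_nonneg m; omega
  rw [this] at hm'
  omega

lemma xnot_mem {τ : ℂ} (hτ : 0 < τ.im) {N : ℕ} {t : ℕ} (ht : 0 < t) (hN : t < N) :
    ((t : ℂ) / N) ∉ (xL τ hτ).lattice := by
  intro h
  obtain ⟨m, n, h⟩ := (mem_xL _).1 h
  have hN0 : (N : ℂ) ≠ 0 := by
    have : N ≠ 0 := by omega
    exact_mod_cast this
  have h' := congrArg Complex.im h
  have e : (t : ℂ) / N = (((t : ℝ) / N : ℝ) : ℂ) := by push_cast; rfl
  simp only [e, Complex.add_im, Complex.mul_im, Complex.intCast_re, Complex.intCast_im,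
    Complex.one_im, Complex.one_re, Complex.ofReal_im] at h'
  have hm : (m : ℝ) = 0 := by
    have : (m : ℝ) * τ.im = 0 := by linarith
    exact (mul_eq_zero.1 this).resolve_right hτ.ne'
  have hm : m = 0 := by exact_mod_cast hm
  rw [hm] at h
  simp at h
  rw [eq_div_iff hN0] at h
  have h : n * (N : ℤ) = t := by exact_mod_cast h
  have h1 : 0 < n := by
    by_contra hn
    have : n * (N : ℤ) ≤ 0 := mul_nonpos_of_nonpos_of_nonneg (by omega) (by omega)
    omega
  have : (N : ℤ) ≤ n * N := le_mul_of_one_le_left (by omega) (by omega)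
  omega
/-- For `N > 1` coprime to `6` and `𝔣 = N O_K` in an imaginary quadratic field
`K ≠ ℚ(√−1), ℚ(√−3)`, the quantity `ξ_N = h_E(φ_E(2/N)) − h_E(φ_E(1/N))` satisfies
`ξ_N^{12N} = (j(τ_K)²(j(τ_K)−1728)³/(2³⁰3²⁴))^{2N} · g_𝔣(C₃)/(g_𝔣(C₂)² g_𝔣(C₀))`,
where `g_𝔣(C_t) = g_{[0,t/N]}(τ_K)^{12N}`; in particular `ξ_N ≠ 0`. -/
theorem xiN_pow (K : Type*) [Field K] [NumberField K]
    (h2 : Module.finrank ℚ K = 2) (hneg : NumberField.discr K < 0)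
    (h4 : NumberField.discr K ≠ -4) (h3 : NumberField.discr K ≠ -3)
    (N : ℕ) (hN : 1 < N) (hN6 : Nat.Coprime N 6) :
    (weber (AddSubgroup.closure {tauK K, 1}) (2 / N) -
        weber (AddSubgroup.closure {tauK K, 1}) (1 / N)) ^ (12 * N) =
      (jInv (tauK K) ^ 2 * (jInv (tauK K) - 1728) ^ 3 / (2 ^ 30 * 3 ^ 24)) ^ (2 * N) *
        (siegel 0 (3 / N) (tauK K) ^ (12 * N) /
          (siegel 0 (2 / N) (tauK K) ^ (24 * N) * siegel 0 (1 / N) (tauK K) ^ (12 * N))) ∧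
      weber (AddSubgroup.closure {tauK K, 1}) (2 / N) -
        weber (AddSubgroup.closure {tauK K, 1}) (1 / N) ≠ 0 := by
  have hτ := xtau_pos K hneg
  have hg2 := xg2_ne K h2 hneg h3
  have hg3 := xg3_ne K h2 hneg h4
  set τ := tauK K with hτd
  have hN3 : 3 < N := by
    by_contra h
    have h : N ≤ 3 := by omega
    interval_cases N <;> revert hN6 <;> decide
  have hN0 : (N : ℂ) ≠ 0 := by
    have : N ≠ 0 := by omega
    exact_mod_cast this
  have m1 : (1 / N : ℂ) ∉ (xL τ hτ).lattice := by
    simpa using xnot_mem hτ (N := N) (t := 1) (by omega) (by omega)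
  have m2 : (2 / N : ℂ) ∉ (xL τ hτ).lattice := by
    simpa using xnot_mem hτ (N := N) (t := 2) (by omega) (by omega)
  have m3 : (3 / N : ℂ) ∉ (xL τ hτ).lattice := by
    simpa using xnot_mem hτ (N := N) (t := 3) (by omega) (by omega)
  have t1 := xT_ne_zero' hτ m1
  have t2 := xT_ne_zero' hτ m2
  have t3 := xT_ne_zero' hτ m3
  have hP := wp_sub_wp hτ m2 m1
  rw [show (2 / N : ℂ) + 1 / N = 3 / N by ring, show (2 / N : ℂ) - 1 / N = 1 / N by ring] at hP
  have hD := xT_deriv_zero hτ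
  have hΔ := xdisc_prod hτ
  have hΔ0 := xdisc_ne hτ
  have hQ := xQ12 τ
  have s1 := xsiegel hτ (1 / N)
  have s2 := xsiegel hτ (2 / N)
  have s3 := xsiegel hτ (3 / N)
  push_cast at s1 s2 s3
  have hD12 : (xL τ hτ).g₂ ^ 3 - 27 * (xL τ hτ).g₃ ^ 2 =
      deriv (xT τ) 0 ^ 12 * qpow τ (B2 0 / 2) ^ 12 := by
    rw [hΔ, hQ, hD, show (-(2 * Real.pi * I) * xPhi (exp (2 * Real.pi * I * τ))
      (exp (2 * Real.pi * I * τ)) ^ 2) ^ 12 = (2 * Real.pi) ^ 12 * (I ^ 4) ^ 3 *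
      xPhi (exp (2 * Real.pi * I * τ)) (exp (2 * Real.pi * I * τ)) ^ 24 by ring, I_pow_four]
    ring
  have hD0 : deriv (xT τ) 0 ≠ 0 := by
    intro h; rw [h] at hD12; apply hΔ0; rw [hD12]; simp
  have hQ0 : qpow τ (B2 0 / 2) ≠ 0 := by rw [qpow]; exact exp_ne_zero _
  have hξ : weber (AddSubgroup.closure {τ, 1}) (2 / N) -
      weber (AddSubgroup.closure {τ, 1}) (1 / N) =
      (xL τ hτ).g₂ * (xL τ hτ).g₃ / ((xL τ hτ).g₂ ^ 3 - 27 * (xL τ hτ).g₃ ^ 2) *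
        ((xL τ hτ).weierstrassP (2 / N) - (xL τ hτ).weierstrassP (1 / N)) := by
    rw [weber, weber, discL, xcl hτ, xg2L, xg3L, xwpL, xwpL]; ring
  have hj : jInv τ = 1728 * (xL τ hτ).g₂ ^ 3 /
      ((xL τ hτ).g₂ ^ 3 - 27 * (xL τ hτ).g₃ ^ 2) := by
    rw [jInv, disc, xg2 hτ, xg3 hτ]
  have hj2 : jInv τ - 1728 = 1728 * 27 * (xL τ hτ).g₃ ^ 2 /
      ((xL τ hτ).g₂ ^ 3 - 27 * (xL τ hτ).g₃ ^ 2) := by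
    rw [hj, eq_div_iff hΔ0, sub_mul, div_mul_cancel₀ _ hΔ0]; ring
  rw [hξ, hP, hj2, hj, s1, s2, s3]
  generalize (xL τ hτ).g₂ ^ 3 - 27 * (xL τ hτ).g₃ ^ 2 = Δ at *
  generalize (xL τ hτ).g₂ = u at *
  generalize (xL τ hτ).g₃ = v at *
  generalize deriv (xT τ) 0 = D at *
  generalize xT τ (1 / N) = T1 at *
  generalize xT τ (2 / N) = T2 at *
  generalize xT τ (3 / N) = T3 at *
  generalize qpow τ (B2 0 / 2) = Q at *
  constructor
  · have key : (u * v / Δ * -(D ^ 2 * (T3 * T1) / (T2 ^ 2 * T1 ^ 2))) ^ 6 =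
        (1728 * u ^ 3 / Δ) ^ 2 * (1728 * 27 * v ^ 2 / Δ) ^ 3 / (2 ^ 30 * 3 ^ 24) *
        ((-Q * T3) ^ 6 / ((-Q * T2) ^ 12 * (-Q * T1) ^ 6)) := by
      subst hD12
      field_simp
      norm_num
    rw [show 12 * N = 6 * (2 * N) by ring, show 24 * N = 12 * (2 * N) by ring]
    simp only [pow_mul _ _ (2 * N), ← mul_pow, ← div_pow]
    rw [← mul_pow T2 T1 2] at key
    rw [key]
  · have : u * v / Δ ≠ 0 := div_ne_zero (mul_ne_zero hg2 hg3) hΔ0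
    refine mul_ne_zero this (neg_ne_zero.2 (div_ne_zero ?_ ?_))
    · exact mul_ne_zero (pow_ne_zero _ hD0) (mul_ne_zero t3 t1)
    · exact mul_ne_zero (pow_ne_zero _ t2) (pow_ne_zero _ t1)
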